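/- arXiv:2303.00254 — 3 statements merged into one kernel-verified Lean document; each statement's English description precedes it below -/
import Mathlib

section
/- Let N₁, …, N_k be finite groups. Then the direct product N₁ × ⋯ × N_k satisfies Rose's criterion if and only if each N_i satisfies Rose's criterion. -/
open Pointwise

/-- `K` is a complement of `N` inside the subgroup `H` of `G`:
`K ≤ H`, `K ∩ N = 1` and `KN = H` (as sets). -/
def IsComplementOfIn {G : Type*} [Group G] (K N H : Subgroup G) : Prop :=
  K ≤ H ∧ K ⊓ N = ⊥ ∧ (K : Set G) * (N : Set G) = (H : Set G)

/-- `N` has a complement in the subgroup `H` of `G`. -/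
def HasComplementIn {G : Type*} [Group G] (N H : Subgroup G) : Prop :=
  ∃ K : Subgroup G, IsComplementOfIn K N H

universe u

/-- `N` satisfies Rose's criterion: trivial center and `Inn(N)` has a complement
in `Aut(N)`. -/
def RoseCriterion (N : Type u) [Group N] : Prop :=
  Subgroup.center N = ⊥ ∧ HasComplementIn (MulAut.conj : N →* MulAut N).range ⊤

theorem roseCriterion_iff {N : Type*} [Group N] :
    RoseCriterion N ↔ (∀ g : N, (∀ h, h * g = g * h) → g = 1) ∧
      ∃ K : Subgroup (MulAut N), (∀ g, MulAut.conj g ∈ K → MulAut.conj g = 1) ∧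
        ∀ α : MulAut N, ∃ g, MulAut.conj g * α ∈ K := by
  unfold RoseCriterion HasComplementIn IsComplementOfIn
  refine and_congr ?_ (exists_congr fun K => ?_)
  · simp only [Subgroup.eq_bot_iff_forall, Subgroup.mem_center_iff]
  · simp only [le_top, true_and]
    refine and_congr ?_ ?_
    · rw [Subgroup.eq_bot_iff_forall]
      constructor
      · exact fun h g hg => h _ ⟨hg, g, rfl⟩
      · rintro h _ ⟨hg, g, rfl⟩
        exact h g hg
    · rw [Subgroup.coe_top, Set.eq_univ_iff_forall]
      constructor
      · intro h α
        obtain ⟨κ, hκ, _, ⟨g, rfl⟩, hα⟩ := h α⁻¹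
        refine ⟨g, ?_⟩
        have hα' : α = (MulAut.conj g)⁻¹ * κ⁻¹ := by
          rw [← mul_inv_rev]
          exact inv_eq_iff_eq_inv.1 hα.symm
        rw [hα', mul_inv_cancel_left]
        exact K.inv_mem hκ
      · intro h α
        obtain ⟨g, hg⟩ := h α⁻¹
        refine ⟨_, K.inv_mem hg, MulAut.conj g, ⟨g, rfl⟩, ?_⟩
        simp

theorem MulEquiv.roseCriterion {G H : Type*} [Group G] [Group H] (e : G ≃* H)
    (hG : RoseCriterion G) : RoseCriterion H := by
  rw [roseCriterion_iff] at hG ⊢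
  obtain ⟨hZ, K, hK, hcov⟩ := hG
  have hconj (g : H) : MulAut.congr e.symm (MulAut.conj g) = MulAut.conj (e.symm g) := by
    ext x
    simp [MulAut.congr]
  refine ⟨fun g hg => ?_, K.comap (MulAut.congr e.symm).toMonoidHom, fun g hg => ?_, fun α => ?_⟩
  · apply e.symm.injective
    rw [map_one]
    refine hZ _ fun h => e.injective ?_
    simpa using hg (e h)
  · apply (MulAut.congr e.symm).injective
    rw [map_one, hconj]
    exact hK _ (hconj g ▸ hg)
  · obtain ⟨g, hg⟩ := hcov (MulAut.congr e.symm α)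
    refine ⟨e g, ?_⟩
    change MulAut.congr e.symm _ ∈ K
    rwa [map_mul, hconj, e.symm_apply_apply]

/-- If `K` complements the inner automorphisms of a product, then projecting those elements of `K`
that act on every factor, by inner automorphisms away from the `i`-th one, yields a complement for
the `i`-th factor. -/
theorem RoseCriterion.of_pi {ι : Type*} {N : ι → Type*} [∀ i, Group (N i)]
    (h : RoseCriterion (∀ i, N i)) (i : ι) : RoseCriterion (N i) := by
  classical
  rw [roseCriterion_iff] at h ⊢
  obtain ⟨hZ, K, hK, hcov⟩ := h
  refine ⟨fun g hg => ?_,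
    { carrier := {a | ∃ α ∈ K, (∀ x, α x i = a (x i)) ∧
        ∃ g : ∀ j, N j, ∀ j, j ≠ i → ∀ x, α x j = g j * x j * (g j)⁻¹}
      one_mem' := ⟨1, K.one_mem, by simp, 1, by simp⟩
      mul_mem' := ?_
      inv_mem' := ?_ }, ?_, fun a => ?_⟩
  · have := hZ (Pi.mulSingle i g) fun x => by
      ext j
      by_cases hj : j = i
      · subst hj
        simp [hg]
      · simp [hj]
    simpa using this
  · rintro a b ⟨α, hα, hαa, g, hg⟩ ⟨β, hβ, hβb, k, hk⟩
    refine ⟨α * β, K.mul_mem hα hβ, by simp [hαa, hβb], g * k, fun j hj x => ?_⟩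
    simp [hg j hj, hk j hj, mul_assoc]
  · rintro a ⟨α, hα, hαa, g, hg⟩
    refine ⟨α⁻¹, K.inv_mem hα, fun x => ?_, g⁻¹, fun j hj x => ?_⟩
    · have := hαa (α⁻¹ x)
      rw [MulAut.apply_inv_self] at this
      rw [this, MulAut.inv_apply_self]
    · have := hg j hj (α⁻¹ x)
      rw [MulAut.apply_inv_self] at this
      simp [this, mul_assoc]
  · rintro n ⟨α, hα, hαn, g, hg⟩
    have hconj : MulAut.conj (Function.update g i n) = α := by
      ext x j
      by_cases hj : j = i
      · subst hj
        simp [hαn]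
      · simp [hj, hg j hj]
    have h1 := hK _ (hconj ▸ hα)
    rw [hconj] at h1
    ext m
    simpa [h1] using (hαn (Pi.mulSingle i m)).symm
  · obtain ⟨g, hg⟩ := hcov
      (MulEquiv.piCongrRight (Function.update (fun j => (1 : MulAut (N j))) i a))
    refine ⟨g i, _, hg, by simp, g, fun j hj x => ?_⟩
    simp [hj]

/-- A nontrivial group that is not generated by two nontrivial subgroups centralizing each other.
For groups with trivial center this says that the group is not a direct product of two nontrivial
groups. -/
def IsCentrallyIndecomposable (G : Type*) [Group G] : Prop :=
  Nontrivial G ∧ ∀ H K : Subgroup G, (∀ h ∈ H, ∀ k ∈ K, Commute h k) → H ⊔ K = ⊤ →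
    H = ⊥ ∨ K = ⊥

section Indecomposable

variable {ι : Type*} [Finite ι] {M : ι → Type*} [∀ i, Group (M i)]

theorem IsCentrallyIndecomposable.exists_factors_through {B : Type*} [Group B]
    (hB : IsCentrallyIndecomposable B) (f : (∀ i, M i) →* B) (hf : Function.Surjective f) :
    ∃ i, ∀ x, x i = 1 → f x = 1 := by
  classical
  obtain ⟨hnt, hB⟩ := hB
  obtain ⟨i, a, ha⟩ : ∃ i a, f (Pi.mulSingle i a) ≠ 1 := by
    by_contra! hcon
    have hf1 : f = 1 := MonoidHom.pi_ext fun i a => by simpa using hcon i a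
    obtain ⟨b, hb⟩ := exists_ne (1 : B)
    obtain ⟨x, rfl⟩ := hf b
    exact hb (by simp [hf1])
  have hcomm : ∀ h ∈ (f.comp (MonoidHom.mulSingle M i)).range,
      ∀ k ∈ (Pi.evalMonoidHom M i).ker.map f, Commute h k := by
    rintro _ ⟨a, rfl⟩ _ ⟨x, hx, rfl⟩
    replace hx : x i = 1 := hx
    refine Commute.map (?_ : Commute (Pi.mulSingle i a) x) f
    ext j
    by_cases hj : j = i
    · subst hj
      simp [hx]
    · simp [hj]
  have hsup : (f.comp (MonoidHom.mulSingle M i)).range ⊔ (Pi.evalMonoidHom M i).ker.map f = ⊤ := by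
    rw [eq_top_iff]
    rintro b -
    obtain ⟨x, rfl⟩ := hf b
    rw [← mul_inv_cancel_left (Pi.mulSingle i (x i)) x, map_mul]
    refine Subgroup.mul_mem_sup ⟨x i, rfl⟩ ⟨_, ?_, rfl⟩
    simp
  refine ⟨i, fun x hx => ?_⟩
  rcases hB _ _ hcomm hsup with h | h
  · exact absurd ((Subgroup.eq_bot_iff_forall _).1 h _ ⟨a, rfl⟩) ha
  · exact (Subgroup.eq_bot_iff_forall _).1 h _ ⟨x, hx, rfl⟩

/-- An automorphism of a finite product of indecomposable groups permutes the factors. -/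
theorem MulAut.exists_mulEquiv_of_isCentrallyIndecomposable
    (hM : ∀ i, IsCentrallyIndecomposable (M i)) (α : MulAut (∀ i, M i)) (j : ι) :
    ∃ (i : ι) (e : M i ≃* M j), ∀ x, α x j = e (x i) := by
  classical
  have hfac : ∀ j, ∃ i, ∀ x, x i = 1 → α x j = 1 := fun j =>
    (hM j).exists_factors_through ((Pi.evalMonoidHom M j).comp α.toMonoidHom)
      ((Function.surjective_eval j).comp α.surjective)
  choose f hf using hfac
  have hsurj : Function.Surjective f := by
    intro i
    have := (hM i).1
    obtain ⟨a, ha⟩ := exists_ne (1 : M i)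
    by_contra! hcon
    refine ha (Pi.mulSingle_injective (M := M) i (α.injective ?_))
    ext j
    simpa using hf j _ (Pi.mulSingle_eq_of_ne (hcon j) a)
  have hinj : Function.Injective f := Finite.injective_iff_surjective.2 hsurj
  have hred (x : ∀ i, M i) : α x j = α (Pi.mulSingle (f j) (x (f j))) j := by
    have := hf j ((Pi.mulSingle (f j) (x (f j)))⁻¹ * x) (by simp)
    rw [map_mul, map_inv, Pi.mul_apply, Pi.inv_apply, inv_mul_eq_one] at this
    exact this.symm
  let φ : M (f j) →* M j :=
    ((Pi.evalMonoidHom M j).comp α.toMonoidHom).comp (MonoidHom.mulSingle M (f j))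
  have hφ : Function.Bijective φ := by
    constructor
    · rw [injective_iff_map_eq_one]
      intro a ha
      refine Pi.mulSingle_injective (M := M) (f j) (α.injective ?_)
      ext l
      rw [Pi.mulSingle_one, map_one]
      by_cases hl : l = j
      · subst hl
        exact ha
      · exact hf l _ (Pi.mulSingle_eq_of_ne (hinj.ne hl) a)
    · intro b
      obtain ⟨x, hx⟩ := α.surjective (Pi.mulSingle j b)
      exact ⟨x (f j), (hred x).symm.trans (by simp [hx])⟩
  exact ⟨f j, MulEquiv.ofBijective φ hφ, hred⟩

end Indecomposable

/-- Complements of the inner automorphism groups of the members of a family can be extended to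
a class of isomorphisms between the members that is closed under composition. -/
theorem exists_coherent_mulEquiv {ι : Type*} {M : ι → Type*} [∀ i, Group (M i)]
    (hM : ∀ i, RoseCriterion (M i)) :
    ∃ T : ∀ i j, Set (M i ≃* M j), (∀ i, MulEquiv.refl (M i) ∈ T i i) ∧
      (∀ i j l, ∀ e ∈ T i j, ∀ e' ∈ T j l, e.trans e' ∈ T i l) ∧
      (∀ i (g : M i), MulAut.conj g ∈ T i i → MulAut.conj g = 1) ∧
      ∀ i j (e : M i ≃* M j), ∃ g : M j, e.trans (MulAut.conj g) ∈ T i j := by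
  simp only [roseCriterion_iff] at hM
  choose _ K hK hcov using hM
  let s : Setoid ι :=
    { r := fun i j => Nonempty (M i ≃* M j)
      iseqv := ⟨fun i => ⟨MulEquiv.refl _⟩, fun ⟨e⟩ => ⟨e.symm⟩, fun ⟨e⟩ ⟨e'⟩ => ⟨e.trans e'⟩⟩ }
  let rep (i : ι) : ι := (Quotient.mk s i).out
  have hrep (i : ι) : Nonempty (M i ≃* M (rep i)) := s.symm (Quotient.mk_out i)
  have hrep_eq {i j : ι} (e : M i ≃* M j) : rep i = rep j :=
    congrArg Quotient.out (Quotient.sound (s := s) ⟨e⟩)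
  let T (r i j : ι) : Set (M i ≃* M j) :=
    {e | ∃ (hi : Nonempty (M i ≃* M r)) (hj : Nonempty (M j ≃* M r)), ∃ κ ∈ K r,
      ∀ x, hj.some (e x) = κ (hi.some x)}
  refine ⟨fun i j => T (rep i) i j, fun i => ?_, fun i j l e he e' he' => ?_, fun i g hg => ?_,
    fun i j e => ?_⟩
  · exact ⟨hrep i, hrep i, 1, (K _).one_mem, fun x => rfl⟩
  · dsimp only at he'
    rw [← hrep_eq e] at he'
    obtain ⟨hi, hj, κ, hκ, h⟩ := he
    obtain ⟨_, hl, κ', hκ', h'⟩ := he'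
    exact ⟨hi, hl, κ' * κ, (K _).mul_mem hκ' hκ, fun x => by simp [h', h]⟩
  · obtain ⟨hi, _, κ, hκ, h⟩ := hg
    have hκ_conj : κ = MulAut.conj (hi.some g) := by
      ext x
      obtain ⟨y, rfl⟩ := hi.some.surjective x
      rw [← h]
      simp
    have hκ1 : κ = 1 := by
      rw [hκ_conj] at hκ ⊢
      exact hK _ _ hκ
    ext x
    apply hi.some.injective
    rw [h, hκ1]
    rfl
  · have hj : Nonempty (M j ≃* M (rep i)) := hrep_eq e ▸ hrep j
    obtain ⟨g, hg⟩ := hcov (rep i) (((hrep i).some.symm.trans e).trans hj.some)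
    exact ⟨hj.some.symm g, hrep i, hj, _, hg, fun x => by simp⟩

theorem RoseCriterion.pi_of_isCentrallyIndecomposable {ι : Type*} [Finite ι] {M : ι → Type*}
    [∀ i, Group (M i)] [∀ i, Finite (M i)] (hM : ∀ i, IsCentrallyIndecomposable (M i))
    (hR : ∀ i, RoseCriterion (M i)) : RoseCriterion (∀ i, M i) := by
  classical
  obtain ⟨T, hT_refl, hT_trans, hT_conj, hT_cov⟩ := exists_coherent_mulEquiv hR
  have : Finite (MulAut (∀ i, M i)) := Finite.of_injective _ DFunLike.coe_injective
  let S : Submonoid (MulAut (∀ i, M i)) :=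
    { carrier := {α | ∀ j, ∃ i, ∃ e ∈ T i j, ∀ x, α x j = e (x i)}
      one_mem' := fun j => ⟨j, _, hT_refl j, fun x => rfl⟩
      mul_mem' := fun {α β} hα hβ j => by
        obtain ⟨i, e, he, h⟩ := hα j
        obtain ⟨l, e', he', h'⟩ := hβ i
        exact ⟨l, _, hT_trans _ _ _ _ he' _ he, fun x => by simp [h, h']⟩ }
  rw [roseCriterion_iff]
  refine ⟨fun g hg => ?_, { S with inv_mem' := fun {α} hα => ?_ }, fun g hg => ?_, fun α => ?_⟩
  · ext i
    refine (roseCriterion_iff.1 (hR i)).1 _ fun h => ?_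
    simpa using congrFun (hg (Pi.mulSingle i h)) i
  · have hmem : α⁻¹ ∈ Submonoid.powers α :=
      mem_powers_iff_mem_zpowers.2 (inv_mem (Subgroup.mem_zpowers α))
    exact Submonoid.powers_le.2 hα hmem
  · ext x j
    obtain ⟨i, e, he, h⟩ := hg j
    by_cases hij : i = j
    · subst hij
      have heq : e = MulAut.conj (g i) := by
        ext a
        simpa using (h (Pi.mulSingle i a)).symm
      rw [h, heq, hT_conj i (g i) (heq ▸ he)]
      rfl
    · have := (hM i).1
      obtain ⟨a, ha⟩ := exists_ne (1 : M i)
      have hea : 1 = e a := by simpa [Ne.symm hij] using h (Pi.mulSingle i a)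
      exact absurd (e.map_eq_one_iff.1 hea.symm) ha
  · choose f e he using MulAut.exists_mulEquiv_of_isCentrallyIndecomposable hM α
    choose g hg using fun j => hT_cov (f j) j (e j)
    exact ⟨g, fun j => ⟨f j, _, hg j, fun x => by simp [he]⟩⟩

/-- `G` is isomorphic to a finite product of indecomposable groups. -/
def HasIndecomposableDecomposition (G : Type u) [Group G] : Prop :=
  ∃ (ι : Type) (_ : Finite ι) (M : ι → Type u) (_ : ∀ i, Group (M i)),
    (∀ i, IsCentrallyIndecomposable (M i)) ∧ Nonempty (G ≃* ∀ i, M i)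

/-- Currying, as a multiplicative equivalence between a product over a sigma type and an iterated
product. -/
def MulEquiv.piSigmaCurry {ι : Type*} {κ : ι → Type*} (M : ∀ i, κ i → Type*)
    [∀ i j, Mul (M i j)] : (∀ p : Σ i, κ i, M p.1 p.2) ≃* ∀ i j, M i j where
  toEquiv := Equiv.piCurry M
  map_mul' _ _ := rfl

theorem HasIndecomposableDecomposition.of_mulEquiv_pi {ι : Type} [Finite ι] {G : Type u} [Group G]
    {N : ι → Type u} [∀ i, Group (N i)] (e : G ≃* ∀ i, N i)
    (h : ∀ i, HasIndecomposableDecomposition (N i)) : HasIndecomposableDecomposition G := by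
  choose κ hκ M hM hind f using h
  exact ⟨Σ i, κ i, inferInstance, fun p => M p.1 p.2, inferInstance, fun p => hind p.1 p.2,
    ⟨(e.trans (MulEquiv.piCongrRight fun i => (f i).some)).trans (MulEquiv.piSigmaCurry M).symm⟩⟩

theorem hasIndecomposableDecomposition_of_center_eq_bot (G : Type u) [Group G] [Finite G]
    (hZ : Subgroup.center G = ⊥) : HasIndecomposableDecomposition G := by
  induction hn : Nat.card G using Nat.strong_induction_on generalizing G with
  | _ n ih =>
    subst hn
    rcases subsingleton_or_nontrivial G with hG | hG
    · have : Unique G := uniqueOfSubsingleton 1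
      exact ⟨Empty, inferInstance, fun _ => G, inferInstance, fun i => i.elim,
        ⟨{ Equiv.ofUnique G (Empty → G) with map_mul' := fun _ _ => Subsingleton.elim _ _ }⟩⟩
    by_cases hind : IsCentrallyIndecomposable G
    · exact ⟨Unit, inferInstance, fun _ => G, inferInstance, fun _ => hind,
        ⟨(MulEquiv.piUnique fun _ : Unit => G).symm⟩⟩
    simp only [IsCentrallyIndecomposable, hG, true_and, not_forall, not_or] at hind
    obtain ⟨H, K, hcomm, hsup, hH, hK⟩ := hind
    have hbot {g : G} (hgH : ∀ h ∈ H, Commute h g) (hgK : ∀ k ∈ K, Commute k g) : g = 1 := by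
      rw [← Subgroup.mem_bot, ← hZ, Subgroup.mem_center_iff]
      have hle : H ⊔ K ≤ Subgroup.centralizer {g} := sup_le
        (fun h hh => Subgroup.mem_centralizer_singleton_iff.2 (hgH h hh))
        (fun k hk => Subgroup.mem_centralizer_singleton_iff.2 (hgK k hk))
      exact fun x => Subgroup.mem_centralizer_singleton_iff.1 (hle (hsup ▸ Subgroup.mem_top x))
    have key (A B : Subgroup G) (hAB : ∀ a ∈ A, ∀ b ∈ B, Commute a b) (hB : B ≠ ⊥)
        (hbot : ∀ g : G, (∀ a ∈ A, Commute a g) → (∀ b ∈ B, Commute b g) → g = 1) :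
        HasIndecomposableDecomposition A := by
      refine ih (Nat.card A) ?_ A ?_ rfl
      · refine lt_of_le_of_ne (Subgroup.card_le_card_group A) fun hcard => hB ?_
        rw [Subgroup.card_eq_iff_eq_top] at hcard
        rw [Subgroup.eq_bot_iff_forall]
        intro b hb
        have hbA : ∀ a, Commute a b := fun a => hAB a (hcard ▸ Subgroup.mem_top a) b hb
        exact hbot b (fun a _ => hbA a) (fun a _ => hbA a)
      · rw [Subgroup.eq_bot_iff_forall]
        intro a ha
        rw [Subgroup.mem_center_iff] at ha
        exact Subtype.ext (hbot a (fun x hx => congrArg Subtype.val (ha ⟨x, hx⟩))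
          fun b hb => (hAB a a.2 b hb).symm)
    have hcomm' : ∀ k ∈ K, ∀ h ∈ H, Commute k h := fun k hk h hh => (hcomm h hh k hk).symm
    let S (b : Bool) : Subgroup G := cond b H K
    have hS : Pairwise fun i j => ∀ x y : G, x ∈ S i → y ∈ S j → Commute x y := by
      rintro (_ | _) (_ | _) hij x y hx hy
      · exact absurd rfl hij
      · exact hcomm' x hx y hy
      · exact hcomm x hx y hy
      · exact absurd rfl hij
    have hdisj : Disjoint H K := by
      rw [Subgroup.disjoint_def]
      exact fun {x} hxH hxK => hbot (fun h hh => hcomm h hh x hxK) fun k hk => hcomm' k hk x hxH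
    have hbij : Function.Bijective (Subgroup.noncommPiCoprod hS) := by
      constructor
      · apply Subgroup.injective_noncommPiCoprod_of_iSupIndep
        rw [iSupIndep_pair (i := true) (j := false) (by decide) (by decide)]
        exact hdisj
      · rw [← MonoidHom.range_eq_top, Subgroup.noncommPiCoprod_range, iSup_bool_eq]
        exact hsup
    refine .of_mulEquiv_pi (MulEquiv.ofBijective _ hbij).symm ?_
    rintro (_ | _)
    · exact key K H hcomm' hH fun g hgK hgH => hbot hgH hgK
    · exact key H K hcomm hK fun g hgH hgK => hbot hgH hgK

/-- A finite direct product `N₁ × ⋯ × N_k` satisfies Rose's criterion if and only if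
each factor `Nᵢ` does. -/
theorem roseCriterion_pi_iff {k : ℕ} (N : Fin k → Type u)
    [∀ i, Group (N i)] [∀ i, Finite (N i)] :
    RoseCriterion (∀ i, N i) ↔ ∀ i, RoseCriterion (N i) := by
  refine ⟨fun h i => h.of_pi i, fun h => ?_⟩
  choose κ _ M _ hind e using fun i =>
    hasIndecomposableDecomposition_of_center_eq_bot (N i) (h i).1
  have hfin (i) (j : κ i) : Finite (M i j) :=
    Finite.of_surjective (fun x => (e i).some x j)
      ((Function.surjective_eval j).comp (e i).some.surjective)
  have hR : RoseCriterion (∀ p : Σ i, κ i, M p.1 p.2) :=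
    .pi_of_isCentrallyIndecomposable (fun p => hind p.1 p.2)
      fun p => ((e p.1).some.roseCriterion (h p.1)).of_pi p.2
  exact ((MulEquiv.piSigmaCurry M).trans
    (MulEquiv.piCongrRight fun i => (e i).some.symm)).roseCriterion hR
end

section
/- For every finite nonabelian nilpotent group N, Gaschütz' theorem does not hold for N; that is, there exist a finite group G, a normal subgroup N₀ of G isomorphic to N, and a subgroup H of G with N₀ ≤ H such that gcd(|N₀|, [G : H]) = 1 and N₀ has a complement in H but no complement in G. -/
open Pointwise

universe u

/-- Gaschütz' theorem holds for the finite group `N`: whenever `N` is embedded as a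
normal subgroup of a finite group `G`, `H` is a subgroup with `N ≤ H ≤ G`,
`gcd(|N|, [G : H]) = 1` and `N` has a complement in `H`, then `N` has a complement
in `G`. -/
def GaschuetzHolds (N : Type u) [Group N] : Prop :=
  ∀ (G : Type u) [Group G] [Finite G] (f : N →* G) (H : Subgroup G),
    Function.Injective f → f.range.Normal → f.range ≤ H →
    Nat.Coprime (Nat.card N) H.index →
    HasComplementIn f.range H → HasComplementIn f.range ⊤

open scoped commutatorElement

/-- A nonabelian nilpotent group has a nontrivial central commutator. -/
theorem exists_commutator_ne_one_mem_center {N : Type*} [Group N]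
    (hnil : Group.IsNilpotent N) (hna : ¬ ∀ a b : N, a * b = b * a) :
    ∃ x y : N, ⁅x, y⁆ ≠ 1 ∧ ⁅x, y⁆ ∈ Subgroup.center N := by
  by_contra! h
  obtain ⟨n, hn⟩ := hnil.nilpotent'
  have hle : ∀ k, Subgroup.upperCentralSeries N k ≤ Subgroup.center N := by
    intro k
    induction k with
    | zero => simp
    | succ k ih =>
      intro x hx
      rw [Subgroup.mem_upperCentralSeries_succ_iff] at hx
      rw [Subgroup.mem_center_iff]
      intro y
      have hxy : ⁅x, y⁆ = 1 := by
        by_contra hne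
        exact h x y hne (ih (hx y))
      exact (commutatorElement_eq_one_iff_mul_comm.mp hxy).symm
  refine hna fun a b => ?_
  have hb : b ∈ Subgroup.center N := hle n (hn ▸ Subgroup.mem_top b)
  exact Subgroup.mem_center_iff.mp hb a

namespace RegularWreathProduct

variable {D Q : Type*} [Group D] [Group Q]

/-- The inclusion of the base group `Q → D` into `D ≀ᵣ Q`. -/
def baseHom : (Q → D) →* D ≀ᵣ Q where
  toFun v := ⟨v, 1⟩
  map_one' := rfl
  map_mul' _ _ := by ext <;> simp

@[simp]
theorem left_baseHom (v : Q → D) : (baseHom v : D ≀ᵣ Q).left = v := rfl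

@[simp]
theorem right_baseHom (v : Q → D) : (baseHom v : D ≀ᵣ Q).right = 1 := rfl

/-- A homomorphism that kills the top group takes the same values on all coordinate copies
of `D` in the base group. -/
theorem map_baseHom_mulSingle_eq [DecidableEq Q] {M : Type*} [Group M] (g : D ≀ᵣ Q →* M)
    (hg : ∀ r : Q, g (inl r) = 1) (i j : Q) (y : D) :
    g (baseHom (Pi.mulSingle i y)) = g (baseHom (Pi.mulSingle j y)) := by
  have hconj : (inl (j * i⁻¹) : D ≀ᵣ Q) * baseHom (Pi.mulSingle i y) =
      baseHom (Pi.mulSingle j y) * inl (j * i⁻¹) := by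
    ext t
    · have hiff : i * j⁻¹ * t = i ↔ t = j := by
        rw [mul_assoc, mul_eq_left, inv_mul_eq_one, eq_comm]
      by_cases ht : t = j <;> simp [Pi.mulSingle_apply, hiff, ht]
    · simp
  simpa [hg] using congrArg g hconj

/-- A homomorphism from a wreath product with nontrivial top group `Q` to a group of order
coprime to `|Q|` kills the diagonal commutators of the base group. -/
theorem map_baseHom_const_commutator [Finite Q] [Nontrivial Q] {M : Type*} [Group M]
    (hcop : Nat.Coprime (Nat.card M) (Nat.card Q)) (g : D ≀ᵣ Q →* M) (x y : D) :
    g (baseHom fun _ => ⁅x, y⁆) = 1 := by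
  classical
  have hg : ∀ r : Q, g (inl r) = 1 := fun r => by
    rw [← orderOf_eq_one_iff]
    exact Nat.eq_one_of_dvd_coprimes hcop (orderOf_dvd_natCard _)
      ((orderOf_map_dvd (g.comp inl) r).trans (orderOf_dvd_natCard r))
  change (fun _ => ⁅x, y⁆) ∈ (g.comp baseHom).ker
  refine Subgroup.pi_mem_of_mulSingle_mem _ fun i => ?_
  obtain ⟨j, hj⟩ := exists_ne i
  have hcomm : (Pi.mulSingle i ⁅x, y⁆ : Q → D) =
      ⁅(Pi.mulSingle i x : Q → D), Pi.mulSingle i y⁆ :=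
    map_commutatorElement (MonoidHom.mulSingle (fun _ : Q => D) i) x y
  have hone : ⁅(Pi.mulSingle i x : Q → D), Pi.mulSingle j y⁆ = 1 :=
    commutatorElement_eq_one_iff_commute.mpr
      (Pi.mulSingle_commute (f := fun _ => D) hj.symm x y)
  rw [MonoidHom.mem_ker, hcomm, map_commutatorElement, MonoidHom.comp_apply, MonoidHom.comp_apply,
    map_baseHom_mulSingle_eq g hg i j y, ← map_commutatorElement, ← map_commutatorElement, hone,
    map_one, map_one]

end RegularWreathProduct

open RegularWreathProduct

section CentralProduct

variable (N Q : Type*) [Group N] [Group Q]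

/-- The subgroup of `N × (N ≀ᵣ Q)` consisting of the pairs of a central element of `N` and
the corresponding diagonal element of the base group. -/
def centerDiagonal : Subgroup (N × (N ≀ᵣ Q)) :=
  ((Subgroup.center N).subtype.prod
    ((baseHom.comp (Pi.constMonoidHom Q N)).comp (Subgroup.center N).subtype)).range

variable {N Q}

theorem mem_centerDiagonal {p : N × (N ≀ᵣ Q)} :
    p ∈ centerDiagonal N Q ↔
      p.1 ∈ Subgroup.center N ∧ p.2 = baseHom fun _ => p.1 := by
  constructor
  · rintro ⟨z, rfl⟩
    exact ⟨z.2, rfl⟩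
  · rintro ⟨hz, hp⟩
    exact ⟨⟨p.1, hz⟩, Prod.ext rfl hp.symm⟩

instance centerDiagonal_normal : (centerDiagonal N Q).Normal := by
  suffices hle : centerDiagonal N Q ≤ Subgroup.center _ from
    ⟨fun p hp q => by rwa [Subgroup.mem_center_iff.mp (hle hp) q, mul_inv_cancel_right]⟩
  intro p hp
  obtain ⟨hz, hp⟩ := mem_centerDiagonal.mp hp
  rw [Subgroup.mem_center_iff] at hz ⊢
  rintro ⟨n, e⟩
  refine Prod.ext (hz n) ?_
  ext t
  · simp [hp, hz]
  · simp [hp]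

variable (N Q) in
/-- The central product of `N` and `N ≀ᵣ Q`, amalgamating the centre of `N` with its diagonal
copy in the base group. -/
abbrev WreathCentralProduct : Type _ := (N × (N ≀ᵣ Q)) ⧸ centerDiagonal N Q

namespace WreathCentralProduct

/-- The quotient map onto the central product. -/
abbrev mkHom : N × (N ≀ᵣ Q) →* WreathCentralProduct N Q :=
  QuotientGroup.mk' (centerDiagonal N Q)

/-- The inclusion of `N` as the first factor. -/
def leftHom : N →* WreathCentralProduct N Q :=
  mkHom.comp (MonoidHom.inl N (N ≀ᵣ Q))

theorem leftHom_apply (n : N) : (leftHom n : WreathCentralProduct N Q) = mkHom (n, 1) := rfl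

/-- The projection onto the top group of the wreath product. -/
def topHom : WreathCentralProduct N Q →* Q :=
  QuotientGroup.lift _ (rightHom.comp (MonoidHom.snd N (N ≀ᵣ Q))) fun p hp => by
    simp [(mem_centerDiagonal.mp hp).2]

theorem topHom_mkHom (p : N × (N ≀ᵣ Q)) : topHom (mkHom p) = p.2.right := rfl

theorem topHom_surjective : Function.Surjective (topHom : WreathCentralProduct N Q →* Q) :=
  fun r => ⟨mkHom (1, inl r), rfl⟩

theorem mkHom_surjective :
    Function.Surjective (mkHom : N × (N ≀ᵣ Q) →* WreathCentralProduct N Q) :=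
  QuotientGroup.mk'_surjective _

theorem leftHom_injective :
    Function.Injective (leftHom : N →* WreathCentralProduct N Q) := by
  rw [injective_iff_map_eq_one]
  intro n hn
  have hmem : (n, (1 : N ≀ᵣ Q)) ∈ centerDiagonal N Q := (QuotientGroup.eq_one_iff _).mp hn
  have h := congrArg (fun e => e.left 1) (mem_centerDiagonal.mp hmem).2
  exact h.symm

instance leftHom_range_normal :
    (leftHom : N →* WreathCentralProduct N Q).range.Normal where
  conj_mem := by
    rintro _ ⟨n, rfl⟩ g
    obtain ⟨⟨m, e⟩, rfl⟩ := mkHom_surjective g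
    refine ⟨m * n * m⁻¹, ?_⟩
    rw [leftHom_apply, leftHom_apply, ← map_mul, ← map_inv, ← map_mul]
    simp

theorem leftHom_range_le_ker_topHom :
    (leftHom : N →* WreathCentralProduct N Q).range ≤ topHom.ker := by
  rintro _ ⟨n, rfl⟩
  rfl

theorem index_ker_topHom :
    (topHom : WreathCentralProduct N Q →* Q).ker.index = Nat.card Q := by
  rw [Subgroup.index_ker, MonoidHom.range_eq_top.mpr topHom_surjective]
  exact Subgroup.card_top

/-- The graph of the projection of the base group onto its coordinate at `1` is a complement
of `N` in the kernel of `topHom`. -/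
theorem hasComplementIn_ker_topHom :
    HasComplementIn (leftHom : N →* WreathCentralProduct N Q).range topHom.ker := by
  refine ⟨(mkHom.comp ((Pi.evalMonoidHom (fun _ : Q => N) 1).prod baseHom)).range, ?_, ?_, ?_⟩
  · rintro _ ⟨v, rfl⟩
    rfl
  · rw [eq_bot_iff]
    rintro _ ⟨⟨v, rfl⟩, n, hn⟩
    have hmem := mem_centerDiagonal.mp (QuotientGroup.eq.mp hn)
    have hv : v = fun _ => n⁻¹ * v 1 := by
      simpa using congrArg RegularWreathProduct.left hmem.2
    have hn1 : n = 1 := by simpa using congrFun hv 1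
    rw [Subgroup.mem_bot, ← hn, hn1]
    rfl
  · ext g
    constructor
    · rintro ⟨_, ⟨v, rfl⟩, _, ⟨n, rfl⟩, rfl⟩
      exact mul_mem (show _ ∈ topHom.ker from rfl) (leftHom_range_le_ker_topHom ⟨n, rfl⟩)
    · intro hg
      obtain ⟨⟨n, e⟩, rfl⟩ := mkHom_surjective g
      have he : e = baseHom e.left := RegularWreathProduct.ext rfl hg
      refine ⟨_, ⟨e.left, rfl⟩, _, ⟨(e.left 1)⁻¹ * n, rfl⟩, ?_⟩
      change mkHom (e.left 1, baseHom e.left) * mkHom ((e.left 1)⁻¹ * n, 1) = _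
      rw [← map_mul, ← he]
      simp

/-- A complement of `N` in the central product is the graph of a homomorphism `N ≀ᵣ Q →* N`
that restricts to the identity on the amalgamated centre. -/
theorem exists_hom_of_hasComplementIn_top
    (h : HasComplementIn (leftHom : N →* WreathCentralProduct N Q).range ⊤) :
    ∃ g : N ≀ᵣ Q →* N, ∀ z ∈ Subgroup.center N, g (baseHom fun _ => z) = z := by
  obtain ⟨K, -, hinf, hmul⟩ := h
  have hex : ∀ e : N ≀ᵣ Q, ∃ n : N, mkHom (n, e) ∈ K := by
    intro e
    have he : mkHom (1, e) ∈ ((⊤ : Subgroup (WreathCentralProduct N Q)) : Set _) := trivial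
    rw [← hmul] at he
    obtain ⟨k, hk, _, ⟨n, rfl⟩, hkn⟩ := he
    refine ⟨n⁻¹, ?_⟩
    have hk' : k = mkHom (n⁻¹, e) := by
      rw [eq_mul_inv_of_mul_eq hkn, leftHom_apply, ← map_inv, ← map_mul]
      simp
    exact hk' ▸ hk
  have huniq : ∀ (e : N ≀ᵣ Q) (m n : N), mkHom (m, e) ∈ K → mkHom (n, e) ∈ K → m = n := by
    intro e m n hm hn
    have hK : (leftHom (m * n⁻¹) : WreathCentralProduct N Q) ∈ K := by
      have hdiv := mul_mem hm (inv_mem hn)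
      rw [← map_inv, ← map_mul] at hdiv
      simpa [leftHom_apply] using hdiv
    have hbot : (leftHom (m * n⁻¹) : WreathCentralProduct N Q) ∈
        K ⊓ (leftHom : N →* WreathCentralProduct N Q).range := ⟨hK, _, rfl⟩
    rw [hinf, Subgroup.mem_bot] at hbot
    exact mul_inv_eq_one.mp (leftHom_injective (hbot.trans (map_one leftHom).symm))
  choose g hg using hex
  refine ⟨MonoidHom.mk' g fun a b => huniq (a * b) _ _ (hg _) ?_, fun z hz =>
    huniq _ _ _ (hg _) ?_⟩
  · have hab := mul_mem (hg a) (hg b)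
    rwa [← map_mul] at hab
  · have hone : (mkHom (z, baseHom fun _ => z) : WreathCentralProduct N Q) = 1 :=
      (QuotientGroup.eq_one_iff _).mpr (mem_centerDiagonal.mpr ⟨hz, rfl⟩)
    exact hone ▸ one_mem K

end WreathCentralProduct

end CentralProduct

/-- Gaschütz' theorem fails for every finite nonabelian nilpotent group `N`: there
exist a finite group `G`, a normal subgroup `N₀ ⊴ G` isomorphic to `N` and a subgroup
`H` with `N₀ ≤ H`, `gcd(|N₀|, [G : H]) = 1`, such that `N₀` has a complement in `H`
but not in `G`. -/
theorem not_gaschuetz_of_nilpotent_nonabelian (N : Type u) [Group N] [Finite N]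
    (hnil : Group.IsNilpotent N) (hna : ¬ ∀ a b : N, a * b = b * a) :
    ∃ (G : Type u) (_ : Group G) (_ : Finite G) (N₀ H : Subgroup G) (_ : N₀.Normal),
      Nonempty (N₀ ≃* N) ∧ N₀ ≤ H ∧
      Nat.Coprime (Nat.card N₀) H.index ∧
      HasComplementIn N₀ H ∧ ¬ HasComplementIn N₀ ⊤ := by
  obtain ⟨x, y, hne, hcen⟩ := exists_commutator_ne_one_mem_center hnil hna
  have : Nontrivial N := ⟨⟨_, _, hne⟩⟩
  have hcard : 1 < Nat.card N + 1 := Nat.lt_succ_of_lt Finite.one_lt_card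
  have : Fact (1 < Nat.card N + 1) := ⟨hcard⟩
  let Q := Multiplicative (ZMod (Nat.card N + 1))
  have hcop : Nat.Coprime (Nat.card N) (Nat.card Q) := by
    have hQ : Nat.card Q = Nat.card N + 1 := Nat.card_zmod _
    rw [hQ]
    simp
  have hequiv := MonoidHom.ofInjective (WreathCentralProduct.leftHom_injective (N := N) (Q := Q))
  refine ⟨WreathCentralProduct N Q, inferInstance, inferInstance,
    WreathCentralProduct.leftHom.range, WreathCentralProduct.topHom.ker, inferInstance,
    ⟨hequiv.symm⟩, WreathCentralProduct.leftHom_range_le_ker_topHom, ?_,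
    WreathCentralProduct.hasComplementIn_ker_topHom, fun h => ?_⟩
  · rwa [WreathCentralProduct.index_ker_topHom, ← Nat.card_congr hequiv.toEquiv]
  · obtain ⟨g, hg⟩ := WreathCentralProduct.exists_hom_of_hasComplementIn_top h
    exact hne ((hg _ hcen).symm.trans (map_baseHom_const_commutator hcop g x y))
end

section
/- Let N be a finite perfect group (N' = N) with trivial center. Then Gaschütz' theorem holds for N if and only if the inner automorphism group Inn(N) has a complement in Aut(N). -/
open Pointwise

universe u

section FiberWreath

open scoped commutatorElement

variable {A S : Type*} [Group A] [Group S]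

/-- The fibre product over `A ⧸ I` of `A` and the regular wreath product `A ≀ᵣ S`: the pairs
`(a, w)` such that every coordinate of `w` is congruent to `a` modulo `I`. -/
def fiberWreath (I : Subgroup A) [I.Normal] (S : Type*) [Group S] :
    Subgroup (A × (A ≀ᵣ S)) where
  carrier := {g | ∀ i, (g.2.left i : A ⧸ I) = g.1}
  mul_mem' := by
    intro a b ha hb i
    simp only [Set.mem_ofPred_eq] at ha hb
    simp [ha, hb]
  one_mem' := by simp
  inv_mem' := by
    intro a ha i
    simp only [Set.mem_ofPred_eq] at ha
    simp [ha]

theorem mem_fiberWreath {I : Subgroup A} [I.Normal] {g : A × (A ≀ᵣ S)} :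
    g ∈ fiberWreath I S ↔ ∀ i, (g.2.left i : A ⧸ I) = g.1 :=
  Iff.rfl

/-- The base group `S → A` of `A ≀ᵣ S`, embedded in `A × (A ≀ᵣ S)`. -/
def baseEmb (A S : Type*) [Group A] [Group S] : (S → A) →* A × (A ≀ᵣ S) where
  toFun x := (1, ⟨x, 1⟩)
  map_one' := rfl
  map_mul' x y := by
    ext <;> simp

theorem baseEmb_apply (x : S → A) : baseEmb A S x = (1, ⟨x, 1⟩) := rfl

/-- A commutator of two functions of the form `x * (s • x)⁻¹`, where each `x` is supported at `i`,
is supported at `i`. -/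
theorem commutator_mulSingle_translate [DecidableEq S] {s t : S} (hs : s ≠ 1) (ht : t ≠ 1)
    (hst : s ≠ t) (i : S) (n m : A) :
    (⁅(fun j => (Pi.mulSingle i n : S → A) j * ((Pi.mulSingle i n : S → A) (s⁻¹ * j))⁻¹ : S → A),
      (fun j => (Pi.mulSingle i m : S → A) j * ((Pi.mulSingle i m : S → A) (t⁻¹ * j))⁻¹ : S → A)⁆ :
      S → A) = Pi.mulSingle i ⁅n, m⁆ := by
  funext j
  simp only [commutatorElement_def, Pi.mul_apply, Pi.inv_apply, Pi.mulSingle_apply,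
    inv_mul_eq_iff_eq_mul]
  by_cases hj : j = i
  · subst hj
    simp [hs, ht]
  · by_cases h1 : j = s * i
    · have h2 : j ≠ t * i := fun h => hst (mul_right_cancel (h1.symm.trans h))
      simp only [hj, if_false, if_neg h2]
      group
    · simp only [hj, if_false, if_neg h1]
      group

variable {I : Subgroup A} [I.Normal] {K : Subgroup (A × (A ≀ᵣ S))}

theorem inl_mem_of_complement [Finite I] (hcop : (Nat.card I).Coprime (Nat.card S))
    (hK : ∀ a ∈ I, ((a, 1) : A × (A ≀ᵣ S)) ∈ K → a = 1)
    (hsup : ∀ g ∈ fiberWreath I S, ∃ n ∈ I, g * (n, 1) ∈ K) (s : S) :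
    ((1, RegularWreathProduct.inl s) : A × (A ≀ᵣ S)) ∈ K := by
  obtain ⟨n, hn, hk⟩ := hsup (1, RegularWreathProduct.inl s) (by simp [mem_fiberWreath])
  simp only [Prod.mk_mul_mk, one_mul, mul_one] at hk
  have hp : n ^ Nat.card S = 1 := by
    refine hK _ (I.pow_mem hn _) ?_
    simpa [Prod.pow_mk, ← map_pow] using K.pow_mem hk (Nat.card S)
  have hq : n ^ Nat.card I = 1 := by
    exact congrArg Subtype.val (pow_card_eq_one' (x := (⟨n, hn⟩ : I)))
  have h1 : n = 1 := by
    rw [← orderOf_eq_one_iff]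
    exact Nat.eq_one_of_dvd_coprimes hcop (orderOf_dvd_of_pow_eq_one hq)
      (orderOf_dvd_of_pow_eq_one hp)
  rwa [h1] at hk

theorem baseEmb_translate_mem
    (hsup : ∀ g ∈ fiberWreath I S, ∃ n ∈ I, g * (n, 1) ∈ K) {s : S}
    (hs : ((1, RegularWreathProduct.inl s) : A × (A ≀ᵣ S)) ∈ K)
    {x : S → A} (hx : ∀ i, x i ∈ I) :
    baseEmb A S (fun j => x j * (x (s⁻¹ * j))⁻¹) ∈ K := by
  obtain ⟨n, -, hk⟩ := hsup (baseEmb A S x) (by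
    intro i
    simpa [baseEmb_apply, QuotientGroup.eq_one_iff] using hx i)
  have h := K.mul_mem (K.mul_mem (K.mul_mem hk hs) (K.inv_mem hk)) (K.inv_mem hs)
  convert h using 1
  ext <;> simp [baseEmb_apply]

theorem baseEmb_mem_of_complement [Finite S] [Finite I] (hperf : ⁅I, I⁆ = I)
    (hcop : (Nat.card I).Coprime (Nat.card S)) (hS : 2 < Nat.card S)
    (hK : ∀ a ∈ I, ((a, 1) : A × (A ≀ᵣ S)) ∈ K → a = 1)
    (hsup : ∀ g ∈ fiberWreath I S, ∃ n ∈ I, g * (n, 1) ∈ K)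
    {x : S → A} (hx : ∀ i, x i ∈ I) : baseEmb A S x ∈ K := by
  classical
  have := Fintype.ofFinite S
  obtain ⟨s, t, hs, ht, hst⟩ : ∃ s t : S, s ≠ 1 ∧ t ≠ 1 ∧ s ≠ t := by
    rw [← Set.ncard_univ] at hS
    obtain ⟨s, -, hs⟩ := Set.exists_mem_notMem_of_ncard_lt_ncard
      (s := ({1} : Set S)) (t := Set.univ) (by rw [Set.ncard_singleton]; omega)
    obtain ⟨t, -, ht⟩ := Set.exists_mem_notMem_of_ncard_lt_ncard
      (s := ({1, s} : Set S)) (t := Set.univ) ((Set.ncard_insert_le _ _).trans_lt (by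
        rw [Set.ncard_singleton]; omega))
    simp only [Set.mem_insert_iff, Set.mem_singleton_iff, not_or] at hs ht
    exact ⟨s, t, hs, ht.1, Ne.symm ht.2⟩
  have hinl := inl_mem_of_complement hcop hK hsup
  have hsingle (i : S) (n : A) (hn : n ∈ I) (j : S) : (Pi.mulSingle i n : S → A) j ∈ I := by
    rw [Pi.mulSingle_apply]
    split_ifs
    exacts [hn, I.one_mem]
  have key (i : S) : I ≤ K.comap ((baseEmb A S).comp (MonoidHom.mulSingle (fun _ => A) i)) := by
    rw [← hperf, Subgroup.commutator_le]
    intro n hn m hm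
    have h1 := baseEmb_translate_mem hsup (hinl s) (hsingle i n hn)
    have h2 := baseEmb_translate_mem hsup (hinl t) (hsingle i m hm)
    have h3 := K.mul_mem (K.mul_mem (K.mul_mem h1 h2) (K.inv_mem h1)) (K.inv_mem h2)
    rw [← commutatorElement_def, ← map_commutatorElement,
      commutator_mulSingle_translate hs ht hst] at h3
    exact h3
  exact Subgroup.pi_mem_of_mulSingle_mem (H := K.comap (baseEmb A S)) x fun i => key i (hx i)

/-- A complement of `I × 1` in the fibre product meets the preimage of `I` under the first
projection only in elements with trivial first component. -/
theorem fst_eq_one_of_complement [Finite S] [Finite I] (hperf : ⁅I, I⁆ = I)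
    (hcop : (Nat.card I).Coprime (Nat.card S)) (hS : 2 < Nat.card S)
    (hK : ∀ a ∈ I, ((a, 1) : A × (A ≀ᵣ S)) ∈ K → a = 1)
    (hsup : ∀ g ∈ fiberWreath I S, ∃ n ∈ I, g * (n, 1) ∈ K)
    {k : A × (A ≀ᵣ S)} (hk : k ∈ K) (hkG : k ∈ fiberWreath I S) (hkI : k.1 ∈ I) : k.1 = 1 := by
  have hx (i : S) : k.2.left i ∈ I := by
    rw [← QuotientGroup.eq_one_iff, hkG i, QuotientGroup.eq_one_iff]
    exact hkI
  have h1 := baseEmb_mem_of_complement hperf hcop hS hK hsup hx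
  have h2 := inl_mem_of_complement hcop hK hsup k.2.right
  refine hK _ hkI ?_
  convert K.mul_mem hk (K.inv_mem (K.mul_mem h1 h2)) using 1
  ext <;> simp [baseEmb_apply]

end FiberWreath

instance conj_range_normal (N : Type*) [Group N] : (MulAut.conj : N →* MulAut N).range.Normal where
  conj_mem := by
    rintro _ ⟨n, rfl⟩ g
    exact ⟨g n, by ext x; simp⟩

theorem conj_injective_of_center_eq_bot {N : Type*} [Group N] (hz : Subgroup.center N = ⊥) :
    Function.Injective (MulAut.conj : N →* MulAut N) := by
  rw [injective_iff_map_eq_one]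
  intro n hn
  rw [← Subgroup.mem_bot, ← hz, Subgroup.mem_center_iff]
  intro g
  have h := DFunLike.congr_fun hn g
  simp only [MulAut.conj_apply, MulAut.one_apply] at h
  exact (mul_inv_eq_iff_eq_mul.mp h).symm

/-- If `Inn(N)` has a complement in `Aut(N)` and `N` is centerless, then `N` has a complement in
every group containing it as a normal subgroup. -/
theorem hasComplementIn_top_of_conj_range {N : Type*} [Group N] (hz : Subgroup.center N = ⊥)
    (h : HasComplementIn (MulAut.conj : N →* MulAut N).range ⊤)
    {G : Type*} [Group G] (f : N →* G) (hf : Function.Injective f) (hn : f.range.Normal) :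
    HasComplementIn f.range ⊤ := by
  obtain ⟨K, -, hinf, hmul⟩ := h
  let φ : G →* MulAut N :=
    (MulAut.congr (MonoidHom.ofInjective hf).symm).toMonoidHom.comp MulAut.conjNormal
  have hφ (n : N) : φ (f n) = MulAut.conj n := by
    ext m
    apply hf
    simp [φ, MulAut.congr, MonoidHom.apply_ofInjective_symm, MonoidHom.ofInjective_apply]
  refine ⟨K.comap φ, le_top, ?_, ?_⟩
  · rw [eq_bot_iff]
    rintro _ ⟨hk, n, rfl⟩
    have h1 : MulAut.conj n ∈ K ⊓ (MulAut.conj : N →* MulAut N).range :=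
      ⟨hφ n ▸ hk, n, rfl⟩
    rw [hinf, Subgroup.mem_bot] at h1
    have h2 : n = 1 := conj_injective_of_center_eq_bot hz (h1.trans (map_one _).symm)
    simp [h2]
  · refine Set.eq_univ_of_forall fun g => ?_
    obtain ⟨k, hk, _, ⟨n, rfl⟩, hkn⟩ : φ g ∈ (K : Set (MulAut N)) *
        ((MulAut.conj : N →* MulAut N).range : Set (MulAut N)) := by
      rw [hmul]; trivial
    refine ⟨g * (f n)⁻¹, ?_, f n, ⟨n, rfl⟩, by simp⟩
    have h1 : φ (g * (f n)⁻¹) = k := by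
      rw [map_mul, map_inv, hφ, ← hkn]
      simp
    simpa [h1] using hk

/-- `N`, mapped to `A` with range `I`, embedded in the first coordinate of the fibre product. -/
def toFiberWreath {N A : Type*} [Group N] [Group A] (c : N →* A) [c.range.Normal]
    (S : Type*) [Group S] : N →* fiberWreath c.range S :=
  ((MonoidHom.inl A (A ≀ᵣ S)).comp c).codRestrict _ (by
    intro n i
    simpa using ((QuotientGroup.eq_one_iff (N := c.range) (c n)).mpr ⟨n, rfl⟩).symm)

theorem coe_toFiberWreath {N A : Type*} [Group N] [Group A] (c : N →* A) [c.range.Normal]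
    (S : Type*) [Group S] (n : N) :
    (toFiberWreath c S n : A × (A ≀ᵣ S)) = (c n, 1) := rfl

theorem toFiberWreath_range_normal {N A : Type*} [Group N] [Group A] (c : N →* A)
    [hc : c.range.Normal] (S : Type*) [Group S] : (toFiberWreath c S).range.Normal where
  conj_mem := by
    rintro _ ⟨n, rfl⟩ g
    obtain ⟨m, hm⟩ := hc.conj_mem (c n) ⟨n, rfl⟩ g.1.1
    refine ⟨m, Subtype.ext (Prod.ext ?_ ?_)⟩
    · simp [coe_toFiberWreath, hm]
    · simp [coe_toFiberWreath]

/-- The projection of the fibre product to the acting group `S`. -/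
def fiberWreathRight {A : Type*} [Group A] (I : Subgroup A) [I.Normal]
    (S : Type*) [Group S] : fiberWreath I S →* S :=
  (RegularWreathProduct.rightHom.comp (MonoidHom.snd A (A ≀ᵣ S))).comp (fiberWreath I S).subtype

theorem fiberWreathRight_apply {A : Type*} [Group A] (I : Subgroup A) [I.Normal]
    (S : Type*) [Group S] (g : fiberWreath I S) : fiberWreathRight I S g = g.1.2.right := rfl

/-- The copy of `N` has a complement in the kernel of the projection to `S`: the elements whose
first component agrees with the coordinate at `1`. -/
theorem hasComplementIn_ker_fiberWreathRight {N A : Type*} [Group N] [Group A] (c : N →* A)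
    [c.range.Normal] (S : Type*) [Group S] :
    HasComplementIn (toFiberWreath c S).range (fiberWreathRight c.range S).ker := by
  let K : Subgroup (fiberWreath c.range S) :=
    { carrier := {g | g.1.2.right = 1 ∧ g.1.2.left 1 = g.1.1}
      mul_mem' := by
        rintro a b ⟨ha, ha'⟩ ⟨hb, hb'⟩
        simp [ha, ha', hb, hb']
      one_mem' := by simp
      inv_mem' := by
        rintro a ⟨ha, ha'⟩
        simp [ha, ha'] }
  have hKle : K ≤ (fiberWreathRight c.range S).ker := fun g hg => hg.1
  have hNle : (toFiberWreath c S).range ≤ (fiberWreathRight c.range S).ker := by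
    rintro _ ⟨n, rfl⟩
    rfl
  refine ⟨K, hKle, ?_, Set.Subset.antisymm ?_ ?_⟩
  · rw [eq_bot_iff]
    rintro _ ⟨⟨-, hk⟩, n, rfl⟩
    simp only [coe_toFiberWreath, RegularWreathProduct.one_left, Pi.one_apply] at hk
    exact Subtype.ext (Prod.ext hk.symm rfl)
  · rintro _ ⟨k, hk, n, hn, rfl⟩
    exact mul_mem (hKle hk) (hNle hn)
  · intro g hg
    obtain ⟨n, hn⟩ := QuotientGroup.eq.mp (g.2 1)
    refine ⟨g * (toFiberWreath c S n)⁻¹, ⟨?_, ?_⟩, _, ⟨n, rfl⟩, by simp⟩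
    · simpa [coe_toFiberWreath, fiberWreathRight_apply] using hg
    · simp [coe_toFiberWreath, hn]

/-- If the copy of `N` in the fibre product has a complement, then the first projection of this
complement is a complement of the range of `c`. -/
theorem hasComplementIn_of_toFiberWreath {N A : Type*} [Group N] [Finite N] [Group A] (c : N →* A)
    [c.range.Normal] (S : Type*) [Group S] [Finite S] (hperf : commutator N = ⊤)
    (hcop : (Nat.card N).Coprime (Nat.card S)) (hS : 2 < Nat.card S)
    (h : HasComplementIn (toFiberWreath c S).range ⊤) : HasComplementIn c.range ⊤ := by
  obtain ⟨K, -, hinf, hmul⟩ := h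
  have hsup (g : A × (A ≀ᵣ S)) (hg : g ∈ fiberWreath c.range S) :
      ∃ n ∈ c.range, g * (n, 1) ∈ K.map (fiberWreath c.range S).subtype := by
    obtain ⟨k, hk, _, ⟨n, rfl⟩, hkn⟩ : (⟨g, hg⟩ : fiberWreath c.range S) ∈
        (K : Set (fiberWreath c.range S)) *
          ((toFiberWreath c S).range : Set (fiberWreath c.range S)) := by
      rw [hmul]; trivial
    refine ⟨(c n)⁻¹, inv_mem ⟨n, rfl⟩, k, hk, ?_⟩
    have h1 : g = k.1 * (c n, 1) := (congrArg Subtype.val hkn).symm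
    simp [h1, mul_assoc]
  have hK (a : A) (ha : a ∈ c.range)
      (hk : ((a, 1) : A × (A ≀ᵣ S)) ∈ K.map (fiberWreath c.range S).subtype) : a = 1 := by
    obtain ⟨n, rfl⟩ := ha
    obtain ⟨k, hk, hkn⟩ := hk
    have h1 : k ∈ K ⊓ (toFiberWreath c S).range := ⟨hk, n, Subtype.ext hkn.symm⟩
    rw [hinf, Subgroup.mem_bot] at h1
    subst h1
    exact (congrArg Prod.fst hkn).symm
  have : Finite c.range := Set.finite_range c
  have hperf' : ⁅c.range, c.range⁆ = c.range := by
    rw [MonoidHom.range_eq_map, ← Subgroup.map_commutator, ← commutator_def, hperf]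
  have hcop' : (Nat.card c.range).Coprime (Nat.card S) :=
    hcop.coprime_dvd_left (Subgroup.card_range_dvd c)
  refine ⟨(K.map (fiberWreath c.range S).subtype).map (MonoidHom.fst _ _), le_top, ?_, ?_⟩
  · rw [eq_bot_iff]
    rintro _ ⟨⟨_, ⟨k, hk, rfl⟩, rfl⟩, hI⟩
    exact fst_eq_one_of_complement hperf' hcop' hS hK hsup ⟨k, hk, rfl⟩ k.2 hI
  · refine Set.eq_univ_of_forall fun a => ?_
    obtain ⟨n, hn, hk⟩ := hsup (a, ⟨fun _ => a, 1⟩) (fun _ => rfl)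
    exact ⟨a * n, ⟨_, hk, rfl⟩, n⁻¹, inv_mem hn, by simp⟩

/-- For a finite perfect group `N` with trivial center, Gaschütz' theorem holds for
`N` if and only if `Inn(N)` has a complement in `Aut(N)`. -/
theorem gaschuetzHolds_iff_of_perfect (N : Type u) [Group N] [Finite N]
    (hperf : commutator N = ⊤) (hz : Subgroup.center N = ⊥) :
    GaschuetzHolds N ↔
      HasComplementIn (MulAut.conj : N →* MulAut N).range ⊤ := by
  refine ⟨fun h => ?_, fun h G _ _ f H hf hn _ _ _ =>
    hasComplementIn_top_of_conj_range hz h f hf hn⟩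
  obtain ⟨q, hq, hqp⟩ := Nat.exists_infinite_primes (Nat.card N + 3)
  have : NeZero q := ⟨hqp.ne_zero⟩
  have hcard : Nat.card (Multiplicative (ZMod q)) = q := by simp
  have hcop : (Nat.card N).Coprime (Nat.card (Multiplicative (ZMod q))) := by
    rw [hcard]
    exact (Nat.coprime_of_lt_prime Nat.card_pos.ne' (by omega) hqp).symm
  refine hasComplementIn_of_toFiberWreath MulAut.conj (Multiplicative (ZMod q)) hperf hcop
    (by omega) ?_
  have hcompl := hasComplementIn_ker_fiberWreathRight (MulAut.conj : N →* MulAut N)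
    (Multiplicative (ZMod q))
  refine h _ _ _ (fun n m hnm => ?_) (toFiberWreath_range_normal _ _) ?_ ?_ hcompl
  · exact conj_injective_of_center_eq_bot hz
      (congrArg (fun g : fiberWreath _ (Multiplicative (ZMod q)) => g.1.1) hnm)
  · rintro _ ⟨n, rfl⟩
    rfl
  · rw [Subgroup.index_ker]
    exact hcop.coprime_dvd_right (Subgroup.card_subgroup_dvd_card _)
end
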